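/- Let n ≥ 1, let W : ℝⁿ → ℝ be continuous and nonnegative with W(a) = 0 for some a ∈ ℝⁿ, let d(·, a) be the geodesic action distance to a, let D ⊂ ℝ² be open, and let u : D → ℝⁿ. Suppose u is Fréchet differentiable at x ∈ D and the composition d(u(·), a) : D → ℝ is Fréchet differentiable at x. Then ‖D(d∘u)(x)‖ ≤ √(2 W(u(x))) · ‖Du(x)‖, where ‖·‖ denotes the operator norm; consequently ‖D(d∘u)(x)‖ ≤ ½‖Du(x)‖² + W(u(x)). -/

import Mathlib

open Filter MeasureTheory
open scoped ENNReal

/-- The geodesic action distance from the well `a` (at `-∞`) to the point `x` (at time `0`),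
associated to the potential `W`: the infimum of `∫_{-∞}^0 ½‖γ'‖² + W(γ)` over `C¹` curves. -/
noncomputable def actionDist (n : ℕ) (W : EuclideanSpace ℝ (Fin n) → ℝ)
    (a x : EuclideanSpace ℝ (Fin n)) : ℝ≥0∞ :=
  ⨅ γ : {γ : ℝ → EuclideanSpace ℝ (Fin n) //
      ContDiff ℝ 1 γ ∧ Tendsto γ atBot (nhds a) ∧ γ 0 = x},
    ∫⁻ t in Set.Iic (0 : ℝ), ENNReal.ofReal ((1 / 2) * ‖deriv γ.1 t‖ ^ 2 + W (γ.1 t))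

/-- The velocity of a `C¹` curve can be prescribed after time `0` by any continuous
interpolation starting from the velocity at time `0`. -/
lemma exists_contDiff_extension {E : Type*} [NormedAddCommGroup E] [NormedSpace ℝ E]
    [CompleteSpace E] {γ : ℝ → E} (hγ : ContDiff ℝ 1 γ) {χ : ℝ → ℝ} (hχ : Continuous χ)
    (hχ0 : ∀ s ≤ 0, χ s = 0) (z : E) :
    ∃ η : ℝ → E, ContDiff ℝ 1 η ∧ (∀ s ≤ 0, η s = γ s) ∧
      (∀ s ≤ 0, deriv η s = deriv γ s) ∧
      ∀ s, 0 ≤ s → deriv η s = deriv γ 0 + χ s • z := by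
  have hdγ : Continuous (deriv γ) := hγ.continuous_deriv le_rfl
  set g : ℝ → E := fun s => deriv γ (min s 0) + χ s • z with hg
  have hgc : Continuous g := by fun_prop
  have hd : ∀ s, HasDerivAt (fun s => γ 0 + ∫ r in (0 : ℝ)..s, g r) (g s) s := fun s =>
    (intervalIntegral.integral_hasDerivAt_right (hgc.intervalIntegrable _ _)
      (hgc.stronglyMeasurableAtFilter _ _) hgc.continuousAt).const_add _
  have hderiv : deriv (fun s => γ 0 + ∫ r in (0 : ℝ)..s, g r) = g := funext fun s => (hd s).deriv
  have hneg : ∀ s ≤ 0, g s = deriv γ s := fun s hs => by simp [hg, hχ0 s hs, min_eq_left hs]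
  refine ⟨fun s => γ 0 + ∫ r in (0 : ℝ)..s, g r, ?_, ?_, ?_, ?_⟩
  · rw [contDiff_one_iff_deriv, hderiv]
    exact ⟨fun s => (hd s).differentiableAt, hgc⟩
  · intro s hs
    have h1 : ∫ r in (0 : ℝ)..s, g r = ∫ r in (0 : ℝ)..s, deriv γ r := by
      refine intervalIntegral.integral_congr fun r hr => hneg r ?_
      rw [Set.uIcc_of_ge hs] at hr
      exact hr.2
    have h2 : ∫ r in (0 : ℝ)..s, deriv γ r = γ s - γ 0 :=
      intervalIntegral.integral_deriv_eq_sub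
        (fun r _ => (hγ.differentiable one_ne_zero).differentiableAt)
        (hdγ.intervalIntegrable _ _)
    simp [h1, h2]
  · intro s hs
    rw [hderiv, hneg s hs]
  · intro s hs
    rw [hderiv]
    simp [hg, min_eq_right hs]

/-- Continuous cut-off functions vanishing up to time `0` and with integral close to `T` on
`[0, T]`. -/
lemma exists_cutoff {T : ℝ} (hT : 0 < T) (k : ℕ) :
    ∃ χ : ℝ → ℝ, Continuous χ ∧ (∀ s ≤ 0, χ s = 0) ∧ (∀ s, 0 ≤ χ s ∧ χ s ≤ 1) ∧
      ∫ s in (0 : ℝ)..T, χ s = T - T * (1 / ((k : ℝ) + 1)) := by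
  refine ⟨fun s => 1 - (1 - max 0 (min s T) / T) ^ k, by fun_prop, ?_, ?_, ?_⟩
  · intro s hs
    have : max 0 (min s T) = 0 := max_eq_left ((min_le_left _ _).trans hs)
    simp [this]
  · intro s
    have h0 : 0 ≤ max 0 (min s T) / T := by positivity
    have h1 : max 0 (min s T) / T ≤ 1 :=
      (div_le_one hT).2 (max_le hT.le (min_le_right _ _))
    have h2 : (1 - max 0 (min s T) / T) ^ k ≤ 1 := pow_le_one₀ (by linarith) (by linarith)
    have h3 : 0 ≤ (1 - max 0 (min s T) / T) ^ k := pow_nonneg (by linarith) _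
    constructor <;> linarith
  · have h1 : ∫ s in (0 : ℝ)..T, (1 - (1 - max 0 (min s T) / T) ^ k)
        = ∫ s in (0 : ℝ)..T, (1 - (1 - s / T) ^ k) := by
      refine intervalIntegral.integral_congr fun s hs => ?_
      rw [Set.uIcc_of_le hT.le] at hs
      simp [min_eq_left hs.2, max_eq_right hs.1]
    have h2 : ∫ s in (0 : ℝ)..T, (1 - s / T) ^ k = T * (1 / ((k : ℝ) + 1)) := by
      rw [intervalIntegral.integral_comp_sub_div (fun r => r ^ k) hT.ne' 1]
      simp [hT.ne', integral_pow]
    rw [h1, intervalIntegral.integral_sub (by simp)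
      (Continuous.intervalIntegrable (by fun_prop) _ _), h2]
    simp

/-- Following an admissible curve to `p` and then moving to `q` in time `T`, with an interpolation
of velocities governed by `χ`, bounds the action distance of `q`. -/
lemma actionDist_le_of_cutoff {n : ℕ} {W : EuclideanSpace ℝ (Fin n) → ℝ}
    {a p q : EuclideanSpace ℝ (Fin n)} {γ : ℝ → EuclideanSpace ℝ (Fin n)}
    (hγ : ContDiff ℝ 1 γ) (hγa : Tendsto γ atBot (nhds a)) (hγp : γ 0 = p)
    {R M : ℝ} (hM0 : 0 ≤ M) (hM : ∀ y, ‖y - p‖ < R → W y ≤ M) {T : ℝ} (hT : 0 < T)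
    {χ : ℝ → ℝ} (hχ : Continuous χ) (hχ0 : ∀ s ≤ 0, χ s = 0) (hχI : ∀ s, 0 ≤ χ s ∧ χ s ≤ 1)
    {ε : ℝ} (hε : ∫ s in (0 : ℝ)..T, χ s = T - ε) {v : EuclideanSpace ℝ (Fin n)}
    (hv : (T - ε) • v = q - p - ε • deriv γ 0)
    (hR : ε * ‖deriv γ 0‖ + (T - ε) * ‖v‖ < R) :
    actionDist n W a q ≤
      (∫⁻ t in Set.Iic (0 : ℝ), ENNReal.ofReal ((1 / 2) * ‖deriv γ t‖ ^ 2 + W (γ t))) +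
      ENNReal.ofReal ((1 / 2) * (ε * ‖deriv γ 0‖ ^ 2 + (T - ε) * ‖v‖ ^ 2) + M * T) := by
  set w := deriv γ 0 with hw
  obtain ⟨η, hη, hηγ, hdη, hdη'⟩ := exists_contDiff_extension hγ hχ hχ0 (v - w)
  have hηc : Continuous (deriv η) := hη.continuous_deriv le_rfl
  have hη0 : η 0 = p := (hηγ 0 le_rfl).trans hγp
  have hftc : ∀ s, ∫ r in (0 : ℝ)..s, deriv η r = η s - p := fun s => by
    rw [← hη0]
    exact intervalIntegral.integral_deriv_eq_sub
      (fun r _ => (hη.differentiable one_ne_zero).differentiableAt)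
      (hηc.intervalIntegrable _ _)
  have hint : ∀ b c : ℝ, ∫ s in (0 : ℝ)..T, ((1 - χ s) * b + χ s * c) = ε * b + (T - ε) * c := by
    intro b c
    have : ∀ s, (1 - χ s) * b + χ s * c = b + χ s * (c - b) := fun s => by ring
    simp_rw [this]
    rw [intervalIntegral.integral_add (by simp)
      (Continuous.intervalIntegrable (by fun_prop) _ _), intervalIntegral.integral_mul_const, hε]
    simp only [intervalIntegral.integral_const, smul_eq_mul]
    ring
  have hnorm : ∀ s, 0 ≤ s → ‖deriv η s‖ ≤ (1 - χ s) * ‖w‖ + χ s * ‖v‖ := by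
    intro s hs
    have h1 : deriv η s = (1 - χ s) • w + χ s • v := by
      rw [hdη' s hs]
      module
    rw [h1]
    refine (norm_add_le _ _).trans_eq ?_
    rw [norm_smul, norm_smul, Real.norm_of_nonneg (hχI s).1,
      Real.norm_of_nonneg (sub_nonneg.2 (hχI s).2)]
  have hηT : η T = q := by
    have h1 : ∫ r in (0 : ℝ)..T, deriv η r = ∫ r in (0 : ℝ)..T, (w + χ r • (v - w)) := by
      refine intervalIntegral.integral_congr fun r hr => hdη' r ?_
      rw [Set.uIcc_of_le hT.le] at hr
      exact hr.1
    rw [hftc, intervalIntegral.integral_add (by simp)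
      (Continuous.intervalIntegrable (by fun_prop) _ _), intervalIntegral.integral_smul_const, hε,
      intervalIntegral.integral_const, smul_sub, hv] at h1
    have h2 : η T = p + (η T - p) := by abel
    rw [h2, h1]
    module
  have hball : ∀ s ∈ Set.Ioc 0 T, ‖η s - p‖ < R := by
    intro s hs
    refine lt_of_le_of_lt ?_ hR
    rw [← hftc, ← hint]
    have hc : Continuous fun s => (1 - χ s) * ‖w‖ + χ s * ‖v‖ := by fun_prop
    calc ‖∫ r in (0 : ℝ)..s, deriv η r‖ ≤ ∫ r in (0 : ℝ)..s, ‖deriv η r‖ :=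
          intervalIntegral.norm_integral_le_integral_norm hs.1.le
      _ ≤ ∫ r in (0 : ℝ)..s, ((1 - χ r) * ‖w‖ + χ r * ‖v‖) :=
          intervalIntegral.integral_mono_on hs.1.le (hηc.norm.intervalIntegrable _ _)
            (hc.intervalIntegrable _ _) fun r hr => hnorm r hr.1
      _ ≤ ∫ r in (0 : ℝ)..T, ((1 - χ r) * ‖w‖ + χ r * ‖v‖) := by
          refine intervalIntegral.integral_mono_interval le_rfl hs.1.le hs.2
            (Eventually.of_forall fun r => ?_) (hc.intervalIntegrable _ _)
          exact add_nonneg (mul_nonneg (sub_nonneg.2 (hχI r).2) (norm_nonneg _))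
            (mul_nonneg (hχI r).1 (norm_nonneg _))
  set F : ℝ → ℝ≥0∞ := fun t => ENNReal.ofReal ((1 / 2) * ‖deriv η t‖ ^ 2 + W (η t)) with hF
  have hshift : ∫⁻ t in Set.Iic (0 : ℝ), F (t + T) = ∫⁻ t in Set.Iic T, F t := by
    have h := (measurePreserving_add_right (volume : Measure ℝ) T).setLIntegral_comp_preimage_emb
      (MeasurableEquiv.addRight T).measurableEmbedding F (Set.Iic T)
    simpa using h
  have hpast : ∫⁻ t in Set.Iic (0 : ℝ), F t =
      ∫⁻ t in Set.Iic (0 : ℝ), ENNReal.ofReal ((1 / 2) * ‖deriv γ t‖ ^ 2 + W (γ t)) := by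
    refine setLIntegral_congr_fun measurableSet_Iic fun t ht => ?_
    simp only [hF]
    rw [hdη t ht, hηγ t ht]
  have hfuture : ∫⁻ t in Set.Ioc 0 T, F t ≤
      ENNReal.ofReal ((1 / 2) * (ε * ‖w‖ ^ 2 + (T - ε) * ‖v‖ ^ 2) + M * T) := by
    set G : ℝ → ℝ := fun s => (1 / 2) * ((1 - χ s) * ‖w‖ ^ 2 + χ s * ‖v‖ ^ 2) + M with hG
    have hGc : Continuous G := by fun_prop
    have hG0 : ∀ s, 0 ≤ G s := fun s => by
      have h1 := (hχI s).1
      have h2 := sub_nonneg.2 (hχI s).2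
      simp only [hG]
      positivity
    have hGi : ∫ s in Set.Ioc 0 T, G s =
        (1 / 2) * (ε * ‖w‖ ^ 2 + (T - ε) * ‖v‖ ^ 2) + M * T := by
      rw [← intervalIntegral.integral_of_le hT.le, intervalIntegral.integral_add
        (Continuous.intervalIntegrable (by fun_prop) _ _) (by simp),
        intervalIntegral.integral_const_mul, hint]
      simp [mul_comm]
    rw [← hGi, ofReal_integral_eq_lintegral_ofReal (hGc.integrableOn_Ioc)
      (Eventually.of_forall hG0)]
    refine setLIntegral_mono' measurableSet_Ioc fun s hs => ENNReal.ofReal_le_ofReal ?_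
    have h1 := hM _ (hball s hs)
    have h2 : ‖deriv η s‖ ^ 2 ≤ ((1 - χ s) * ‖w‖ + χ s * ‖v‖) ^ 2 :=
      pow_le_pow_left₀ (norm_nonneg _) (hnorm s hs.1.le) 2
    have h3 : 0 ≤ (1 - χ s) * χ s * (‖w‖ - ‖v‖) ^ 2 :=
      mul_nonneg (mul_nonneg (sub_nonneg.2 (hχI s).2) (hχI s).1) (sq_nonneg _)
    simp only [hG]
    nlinarith
  have hadm : ContDiff ℝ 1 (fun t => η (t + T)) ∧
      Tendsto (fun t => η (t + T)) atBot (nhds a) ∧ (fun t => η (t + T)) 0 = q := by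
    refine ⟨hη.comp (contDiff_id.add contDiff_const), ?_, by simpa using hηT⟩
    have h1 : Tendsto η atBot (nhds a) := by
      refine hγa.congr' ?_
      filter_upwards [eventually_le_atBot (0 : ℝ)] with s hs
      exact (hηγ s hs).symm
    exact h1.comp (tendsto_atBot_add_const_right _ _ tendsto_id)
  calc actionDist n W a q
      ≤ ∫⁻ t in Set.Iic (0 : ℝ), F (t + T) := by
        refine (iInf_le _ ⟨fun t => η (t + T), hadm⟩).trans_eq ?_
        simp only [hF, deriv_comp_add_const]
    _ = (∫⁻ t in Set.Iic (0 : ℝ), F t) + ∫⁻ t in Set.Ioc 0 T, F t := by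
        rw [hshift, ← Set.Iic_union_Ioc_eq_Iic hT.le,
          lintegral_union measurableSet_Ioc (Set.Iic_disjoint_Ioc le_rfl)]
    _ ≤ _ := by
        rw [hpast]
        exact add_le_add le_rfl hfuture

/-- Moving from `p` to `q` at constant speed in time `T` costs at most
`‖q - p‖² / (2 T) + M T`, where `M` bounds the potential near `p`. -/
lemma actionDist_le_add_of_time {n : ℕ} {W : EuclideanSpace ℝ (Fin n) → ℝ}
    {a p q : EuclideanSpace ℝ (Fin n)} {R M : ℝ} (hM0 : 0 ≤ M)
    (hM : ∀ y, ‖y - p‖ < R → W y ≤ M) (hq : ‖q - p‖ < R) {T : ℝ} (hT : 0 < T) :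
    actionDist n W a q ≤
      actionDist n W a p + ENNReal.ofReal (‖q - p‖ ^ 2 / (2 * T) + M * T) := by
  rw [actionDist.eq_def n W a p, ENNReal.iInf_add]
  refine le_iInf fun ⟨γ, hγ, hγa, hγp⟩ => ?_
  simp only
  set w := deriv γ 0 with hw
  have hε : Tendsto (fun k : ℕ => T * (1 / ((k : ℝ) + 1))) atTop (nhds 0) := by
    simpa using tendsto_one_div_add_atTop_nhds_zero_nat.const_mul T
  set V : ℝ → EuclideanSpace ℝ (Fin n) := fun ε => (T - ε)⁻¹ • (q - p - ε • w) with hV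
  have hVc : ContinuousAt V 0 := by
    have h1 : ContinuousAt (fun ε : ℝ => (T - ε)⁻¹) 0 :=
      ContinuousAt.inv₀ (by fun_prop) (by simpa using hT.ne')
    exact h1.smul (by fun_prop)
  have hV0 : ‖V 0‖ = ‖q - p‖ / T := by
    simp [hV, norm_smul, abs_of_pos hT, div_eq_inv_mul]
  have hlen : ∀ᶠ k : ℕ in atTop, T * (1 / ((k : ℝ) + 1)) * ‖w‖
      + (T - T * (1 / ((k : ℝ) + 1))) * ‖V (T * (1 / ((k : ℝ) + 1)))‖ < R := by
    have hc : ContinuousAt (fun ε => ε * ‖w‖ + (T - ε) * ‖V ε‖) 0 := by fun_prop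
    refine (hc.tendsto.comp hε).eventually_lt_const ?_
    have hval : 0 * ‖w‖ + (T - 0) * ‖V 0‖ = ‖q - p‖ := by
      rw [hV0]
      field_simp
      ring
    rwa [hval]
  have hcost : Tendsto (fun k : ℕ => (∫⁻ t in Set.Iic (0 : ℝ),
        ENNReal.ofReal ((1 / 2) * ‖deriv γ t‖ ^ 2 + W (γ t))) +
      ENNReal.ofReal ((1 / 2) * (T * (1 / ((k : ℝ) + 1)) * ‖w‖ ^ 2 +
        (T - T * (1 / ((k : ℝ) + 1))) * ‖V (T * (1 / ((k : ℝ) + 1)))‖ ^ 2) + M * T)) atTop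
      (nhds ((∫⁻ t in Set.Iic (0 : ℝ),
        ENNReal.ofReal ((1 / 2) * ‖deriv γ t‖ ^ 2 + W (γ t))) +
        ENNReal.ofReal (‖q - p‖ ^ 2 / (2 * T) + M * T))) := by
    have hc : ContinuousAt
        (fun ε => (1 / 2) * (ε * ‖w‖ ^ 2 + (T - ε) * ‖V ε‖ ^ 2) + M * T) 0 := by fun_prop
    have hval : (1 / 2) * (0 * ‖w‖ ^ 2 + (T - 0) * ‖V 0‖ ^ 2) + M * T
        = ‖q - p‖ ^ 2 / (2 * T) + M * T := by
      rw [hV0]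
      field_simp
      ring
    rw [← hval]
    exact tendsto_const_nhds.add (ENNReal.tendsto_ofReal (hc.tendsto.comp hε))
  refine ge_of_tendsto hcost ?_
  filter_upwards [hlen, hε.eventually_lt_const hT] with k hk hkT
  obtain ⟨χ, hχ, hχ0, hχI, hχT⟩ := exists_cutoff hT k
  refine actionDist_le_of_cutoff hγ hγa hγp hM0 hM hT hχ hχ0 hχI hχT ?_ hk
  simp only [hV]
  rw [smul_smul, mul_inv_cancel₀ (sub_pos.2 hkT).ne', one_smul]

/-- The action distance has slope at most `√(2M)` at `p` if `M` bounds the potential near `p`. -/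
lemma actionDist_le_add {n : ℕ} {W : EuclideanSpace ℝ (Fin n) → ℝ}
    {a p q : EuclideanSpace ℝ (Fin n)} {R M : ℝ} (hM0 : 0 < M)
    (hM : ∀ y, ‖y - p‖ < R → W y ≤ M) (hq : ‖q - p‖ < R) :
    actionDist n W a q ≤
      actionDist n W a p + ENNReal.ofReal (Real.sqrt (2 * M) * ‖q - p‖) := by
  rcases eq_or_ne q p with rfl | hne
  · simp
  have hr : 0 < ‖q - p‖ := norm_pos_iff.2 (sub_ne_zero.2 hne)
  have hs : 0 < Real.sqrt (2 * M) := Real.sqrt_pos.2 (by linarith)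
  have hs2 : Real.sqrt (2 * M) ^ 2 = 2 * M := Real.sq_sqrt (by linarith)
  refine (actionDist_le_add_of_time hM0.le hM hq (div_pos hr hs)).trans_eq ?_
  congr 2
  field_simp
  linear_combination (-1 : ℝ) * hs2

/-- A one-sided increment bound of `f` by the increments of `u` passes to the derivatives. -/
lemma norm_fderiv_le_mul_of_eventually_sub_le {E F : Type*} [NormedAddCommGroup E]
    [NormedSpace ℝ E] [NormedAddCommGroup F] [NormedSpace ℝ F] {f : E → ℝ} {u : E → F} {x : E}
    (hf : DifferentiableAt ℝ f x) (hu : DifferentiableAt ℝ u x) {C : ℝ} (hC : 0 ≤ C)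
    (h : ∀ᶠ y in nhds x, f y - f x ≤ C * ‖u y - u x‖) :
    ‖fderiv ℝ f x‖ ≤ C * ‖fderiv ℝ u x‖ := by
  have key : ∀ v, fderiv ℝ f x v ≤ C * ‖fderiv ℝ u x v‖ := by
    intro v
    have hfv := (hf.hasFDerivAt.hasLineDerivAt v).tendsto_slope_zero_right
    have huv := (hu.hasFDerivAt.hasLineDerivAt v).tendsto_slope_zero_right
    have hline : Tendsto (fun t : ℝ => x + t • v) (nhdsWithin 0 (Set.Ioi 0)) (nhds x) := by
      have : Continuous fun t : ℝ => x + t • v := by fun_prop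
      simpa using (this.tendsto 0).mono_left nhdsWithin_le_nhds
    refine le_of_tendsto_of_tendsto hfv (huv.norm.const_mul C) ?_
    filter_upwards [hline.eventually h, self_mem_nhdsWithin] with t ht ht0
    have ht0' : 0 < t⁻¹ := inv_pos.2 ht0
    simp only [smul_eq_mul, norm_smul]
    rw [Real.norm_of_nonneg ht0'.le, mul_left_comm]
    exact mul_le_mul_of_nonneg_left ht ht0'.le
  refine ContinuousLinearMap.opNorm_le_bound _ (by positivity) fun v => ?_
  have hb : C * ‖fderiv ℝ u x v‖ ≤ C * ‖fderiv ℝ u x‖ * ‖v‖ := by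
    rw [mul_assoc]
    exact mul_le_mul_of_nonneg_left ((fderiv ℝ u x).le_opNorm v) hC
  have h1 := key v
  have h2 := key (-v)
  rw [map_neg, map_neg, norm_neg] at h2
  exact abs_le.2 ⟨by linarith, by linarith⟩

/-- Chain-rule bound for the action distance composed with a map `u : ℝ² → ℝⁿ`. -/
theorem actionDist_comp_deriv_bound
    (n : ℕ) (hn : 1 ≤ n) (W : EuclideanSpace ℝ (Fin n) → ℝ)
    (hW : Continuous W) (hWpos : ∀ p, 0 ≤ W p)
    (a : EuclideanSpace ℝ (Fin n)) (hWa : W a = 0)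
    (D : Set (EuclideanSpace ℝ (Fin 2))) (hD : IsOpen D)
    (u : EuclideanSpace ℝ (Fin 2) → EuclideanSpace ℝ (Fin n))
    (x : EuclideanSpace ℝ (Fin 2)) (hx : x ∈ D)
    (hu : DifferentiableAt ℝ u x)
    (hcomp : DifferentiableAt ℝ (fun y => (actionDist n W a (u y)).toReal) x) :
    ‖fderiv ℝ (fun y => (actionDist n W a (u y)).toReal) x‖
        ≤ Real.sqrt (2 * W (u x)) * ‖fderiv ℝ u x‖ ∧
    ‖fderiv ℝ (fun y => (actionDist n W a (u y)).toReal) x‖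
        ≤ (1 / 2) * ‖fderiv ℝ u x‖ ^ 2 + W (u x) := by
  have hmain : ‖fderiv ℝ (fun y => (actionDist n W a (u y)).toReal) x‖
      ≤ Real.sqrt (2 * W (u x)) * ‖fderiv ℝ u x‖ := by
    by_cases htop : actionDist n W a (u x) = ∞
    · have hmin : IsLocalMin (fun y => (actionDist n W a (u y)).toReal) x :=
        Eventually.of_forall fun y => by simp [htop]
      rw [hmin.fderiv_eq_zero, norm_zero]
      positivity
    have hbound : ∀ M, W (u x) < M → ‖fderiv ℝ (fun y => (actionDist n W a (u y)).toReal) x‖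
        ≤ Real.sqrt (2 * M) * ‖fderiv ℝ u x‖ := by
      intro M hM
      have hM0 : 0 < M := (hWpos _).trans_lt hM
      obtain ⟨R, hR, hRM⟩ := Metric.eventually_nhds_iff.1
        (hW.continuousAt.eventually_lt_const hM)
      refine norm_fderiv_le_mul_of_eventually_sub_le hcomp hu (Real.sqrt_nonneg _) ?_
      filter_upwards [hu.continuousAt.eventually (Metric.ball_mem_nhds _ hR)] with y hy
      have hle := actionDist_le_add (a := a) hM0
        (fun z hz => (hRM (by rwa [dist_eq_norm])).le) (by rwa [← dist_eq_norm] : ‖u y - u x‖ < R)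
      have h := ENNReal.toReal_mono (ENNReal.add_ne_top.2 ⟨htop, ENNReal.ofReal_ne_top⟩) hle
      rw [ENNReal.toReal_add htop ENNReal.ofReal_ne_top,
        ENNReal.toReal_ofReal (by positivity)] at h
      linarith
    have hlim : Tendsto (fun M => Real.sqrt (2 * M) * ‖fderiv ℝ u x‖)
        (nhdsWithin (W (u x)) (Set.Ioi (W (u x))))
        (nhds (Real.sqrt (2 * W (u x)) * ‖fderiv ℝ u x‖)) := by
      have : Continuous fun M => Real.sqrt (2 * M) * ‖fderiv ℝ u x‖ := by fun_prop
      exact (this.tendsto _).mono_left nhdsWithin_le_nhds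
    refine ge_of_tendsto hlim ?_
    filter_upwards [self_mem_nhdsWithin] with M hM using hbound M hM
  refine ⟨hmain, hmain.trans ?_⟩
  have h2 : Real.sqrt (2 * W (u x)) ^ 2 = 2 * W (u x) :=
    Real.sq_sqrt (by linarith [hWpos (u x)])
  nlinarith [sq_nonneg (Real.sqrt (2 * W (u x)) - ‖fderiv ℝ u x‖)]
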